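/- The rectilinear crossing number of complete graphs satisfies limsup_{n→∞} cr(K_n)/binom(n,4) ≤ 83247328/218791125 < 0.380488. (In fact the limit q* := lim_{n→∞} cr(K_n)/binom(n,4) exists and q* ≤ 83247328/218791125.) -/

import Mathlib

/-- A finite planar point set is in general position if no three of its points are collinear. -/
def GenPos (P : Finset (ℝ × ℝ)) : Prop :=
  ∀ p ∈ P, ∀ q ∈ P, ∀ r ∈ P, p ≠ q → p ≠ r → q ≠ r →
    ¬ Collinear ℝ ({p, q, r} : Set (ℝ × ℝ))

/-- A set of points is in convex position if no point lies in the convex hull of the others. -/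
def ConvexPos (S : Set (ℝ × ℝ)) : Prop :=
  ∀ p ∈ S, p ∉ convexHull ℝ (S \ {p})

/-- `crNum P` is the number of 4-element subsets of `P` in convex position. -/
noncomputable def crNum (P : Finset (ℝ × ℝ)) : ℕ :=
  Set.ncard {Q : Finset (ℝ × ℝ) | Q ⊆ P ∧ Q.card = 4 ∧ ConvexPos (↑Q : Set (ℝ × ℝ))}

/-- The rectilinear crossing number of `K_n`: the minimum of `crNum P` over all sets `P` of `n`
points in general position in the plane. -/
noncomputable def rcn (n : ℕ) : ℕ :=
  sInf {c : ℕ | ∃ P : Finset (ℝ × ℝ), P.card = n ∧ GenPos P ∧ crNum P = c}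

/-- The orientation determinant of three points of the plane; it is positive if and only if the
triangle `a b c` is counterclockwise. -/
def orient (a b c : ℝ × ℝ) : ℝ := (b.1 - a.1) * (c.2 - a.2) - (b.2 - a.2) * (c.1 - a.1)

lemma orient_swap (a b c : ℝ × ℝ) : orient b a c = -orient a b c := by
  simp only [orient]
  ring

lemma orient_self_left (a b : ℝ × ℝ) : orient a b a = 0 := by
  simp only [orient]
  ring

lemma orient_self_right (a b : ℝ × ℝ) : orient a b b = 0 := by
  simp only [orient]
  ring

lemma orient_self (a b : ℝ × ℝ) : orient a a b = 0 := by
  simp only [orient]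
  ring

lemma orient_rotate (a b c : ℝ × ℝ) : orient b c a = orient a b c := by
  simp only [orient]
  ring

lemma orient_swap_right (a b c : ℝ × ℝ) : orient a c b = -orient a b c := by
  simp only [orient]
  ring

lemma orient_four (a b c d : ℝ × ℝ) :
    orient a b c + orient a c d = orient a b d + orient b c d := by
  simp only [orient]
  ring

lemma mem_convexHull_of_orient_pos {a b c d : ℝ × ℝ} {S : Set (ℝ × ℝ)} (ha : a ∈ S) (hb : b ∈ S)
    (hc : c ∈ S) (h₁ : 0 < orient a b d) (h₂ : 0 < orient b c d) (h₃ : 0 < orient c a d) :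
    d ∈ convexHull ℝ S := by
  have hs : orient a b c = orient b c d + orient c a d + orient a b d := by
    simp only [orient]
    ring
  have h : 0 < orient a b c := by linarith
  refine mem_convexHull_of_exists_fintype
    ![orient b c d / orient a b c, orient c a d / orient a b c, orient a b d / orient a b c]
    ![a, b, c] ?_ ?_ ?_ ?_
  · intro i
    fin_cases i <;> simp <;> positivity
  · rw [Fin.sum_univ_three]
    simp only [Matrix.cons_val]
    rw [← add_div, ← add_div, ← hs, div_self h.ne']
  · intro i
    fin_cases i <;> simpa
  · rw [Fin.sum_univ_three]
    simp only [Matrix.cons_val]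
    ext
    · simp only [Prod.fst_add, Prod.smul_fst, smul_eq_mul]
      field_simp
      simp only [orient]
      ring
    · simp only [Prod.snd_add, Prod.smul_snd, smul_eq_mul]
      field_simp
      simp only [orient]
      ring

lemma not_convexPos_of_orient {a b c d : ℝ × ℝ} {S : Set (ℝ × ℝ)} (ha : a ∈ S \ {d})
    (hb : b ∈ S \ {d}) (hc : c ∈ S \ {d}) (hd : d ∈ S)
    (h : (0 < orient a b d ∧ 0 < orient b c d ∧ 0 < orient c a d) ∨
      (orient a b d < 0 ∧ orient b c d < 0 ∧ orient c a d < 0)) : ¬ ConvexPos S := by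
  intro hS
  rcases h with ⟨h₁, h₂, h₃⟩ | ⟨h₁, h₂, h₃⟩
  · exact hS d hd (mem_convexHull_of_orient_pos ha hb hc h₁ h₂ h₃)
  · rw [← neg_pos, ← orient_swap] at h₁ h₂ h₃
    exact hS d hd (mem_convexHull_of_orient_pos hb ha hc h₁ h₃ h₂)

open Classical in
/-- The number of ordered pairs of points of `Q` such that all other points of `Q` are to the left
of the ray through the pair. -/
noncomputable def hullEdges (Q : Finset (ℝ × ℝ)) : ℕ :=
  ((Q ×ˢ Q).filter fun e => ∀ c ∈ Q, c ≠ e.1 → c ≠ e.2 → 0 < orient e.1 e.2 c).card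

open Classical in
lemma hullEdges_four {Q : Finset (ℝ × ℝ)} (hQ : Q.card = 4)
    (h : ∀ a ∈ Q, ∀ b ∈ Q, ∀ c ∈ Q, a ≠ b → a ≠ c → b ≠ c → orient a b c ≠ 0) :
    3 + (if ConvexPos (Q : Set (ℝ × ℝ)) then 1 else 0) ≤ hullEdges Q := by
  obtain ⟨a, b, c, d, hab, hac, had, hbc, hbd, hcd, rfl⟩ := Finset.card_eq_four.1 hQ
  have habc := h a (by simp) b (by simp) c (by simp) hab hac hbc
  have habd := h a (by simp) b (by simp) d (by simp) hab had hbd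
  have hacd := h a (by simp) c (by simp) d (by simp) hac had hcd
  have hbcd := h b (by simp) c (by simp) d (by simp) hbc hbd hcd
  have key := orient_four a b c d
  have p₁ := orient_swap_right a b c
  have p₂ := orient_swap_right a b d
  have p₃ := orient_swap_right a c d
  have p₄ := orient_swap_right b c d
  have p₅ := orient_rotate a b c
  have p₆ := orient_rotate a b d
  have p₇ := orient_rotate a c d
  have p₈ := orient_rotate b c d
  rw [hullEdges, Finset.card_filter, Finset.sum_product]
  simp only [Finset.sum_insert, Finset.mem_insert, Finset.mem_singleton, hab, hac, had, hbc, hbd,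
    hcd, hab.symm, hac.symm, had.symm, hbc.symm, hbd.symm, hcd.symm, or_self, not_false_eq_true,
    Finset.sum_singleton, forall_eq_or_imp, forall_eq, ne_eq, not_true_eq_false, false_imp_iff,
    true_imp_iff, orient_self, lt_self_iff_false, and_false, true_and, and_true,
    if_false, zero_add, add_zero, orient_swap a b, orient_swap a c, orient_swap a d,
    orient_swap b c, orient_swap b d, orient_swap c d, p₁, p₂, p₃, p₄, p₅, p₆, p₇, p₈,
    neg_pos, neg_lt_zero]
  have upper :
      (if ConvexPos (({a, b, c, d} : Finset (ℝ × ℝ)) : Set (ℝ × ℝ)) then 1 else 0) ≤ 1 := by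
    split_ifs <;> norm_num
  have mem : ∀ x ∈ ({a, b, c, d} : Finset (ℝ × ℝ)), ∀ y, x ≠ y →
      x ∈ (({a, b, c, d} : Finset (ℝ × ℝ)) : Set (ℝ × ℝ)) \ {y} := fun x hx y hxy => ⟨hx, hxy⟩
  have na := not_convexPos_of_orient (mem b (by simp) a hab.symm) (mem c (by simp) a hac.symm)
    (mem d (by simp) a had.symm) (by simp)
  have nb := not_convexPos_of_orient (mem a (by simp) b hab) (mem c (by simp) b hbc.symm)
    (mem d (by simp) b hbd.symm) (by simp)
  have nc := not_convexPos_of_orient (mem a (by simp) c hac) (mem b (by simp) c hbc)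
    (mem d (by simp) c hcd.symm) (by simp)
  have nd := not_convexPos_of_orient (mem a (by simp) d had) (mem b (by simp) d hbd)
    (mem c (by simp) d hcd) (by simp)
  simp only [orient_swap a c, orient_swap a d, orient_swap b d, p₁, p₂, p₃, p₄,
    p₅, p₆, p₇, p₈, neg_pos, neg_lt_zero, neg_neg] at na nb nc nd
  rcases habc.lt_or_gt with h₁ | h₁ <;> rcases habd.lt_or_gt with h₂ | h₂ <;>
    rcases hacd.lt_or_gt with h₃ | h₃ <;> rcases hbcd.lt_or_gt with h₄ | h₄ <;>
    simp only [h₁, h₂, h₃, h₄, h₁.not_gt, h₂.not_gt, h₃.not_gt, h₄.not_gt, and_true, and_false,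
      and_self, if_true, if_false, or_true, or_false, true_imp_iff] at na nb nc nd ⊢ <;>
    first
    | omega
    | linarith
    | (rw [if_neg ‹_›]; norm_num)

open Classical in
/-- The number of points of `P` to the left of the ray from `a` to `b`. -/
noncomputable def numLeft (P : Finset (ℝ × ℝ)) (a b : ℝ × ℝ) : ℕ :=
  (P.filter fun c => 0 < orient a b c).card

open Classical in
lemma sum_hullEdges_le (P : Finset (ℝ × ℝ)) :
    ∑ Q ∈ P.powersetCard 4, hullEdges Q ≤ ∑ a ∈ P, ∑ b ∈ P, (numLeft P a b).choose 2 := by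
  have h₁ : ∀ Q ∈ P.powersetCard 4, hullEdges Q = ∑ e ∈ P ×ˢ P,
      if e.1 ∈ Q ∧ e.2 ∈ Q ∧ ∀ c ∈ Q, c ≠ e.1 → c ≠ e.2 → 0 < orient e.1 e.2 c
        then 1 else 0 := by
    intro Q hQ
    have hQP := (Finset.mem_powersetCard.1 hQ).1
    rw [hullEdges, ← Finset.card_filter]
    congr 1
    ext ⟨a, b⟩
    simp only [Finset.mem_filter, Finset.mem_product]
    constructor
    · rintro ⟨⟨ha, hb⟩, h⟩
      exact ⟨⟨hQP ha, hQP hb⟩, ha, hb, h⟩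
    · rintro ⟨-, ha, hb, h⟩
      exact ⟨⟨ha, hb⟩, h⟩
  rw [Finset.sum_congr rfl h₁, Finset.sum_comm, Finset.sum_product]
  refine Finset.sum_le_sum fun a _ => Finset.sum_le_sum fun b _ => ?_
  rw [← Finset.card_filter, numLeft, ← Finset.card_powersetCard]
  refine Finset.card_le_card_of_injOn (fun Q => (Q.erase a).erase b) ?_ ?_
  · intro Q hQ
    obtain ⟨hQ, ha, hb, h⟩ := Finset.mem_filter.1 hQ
    obtain ⟨hQP, hcard⟩ := Finset.mem_powersetCard.1 hQ
    have hab : b ≠ a := by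
      rintro rfl
      obtain ⟨c, hc, hcb⟩ := Finset.exists_mem_ne (by omega : 1 < Q.card) b
      have := h c hc hcb hcb
      rw [orient_self] at this
      exact lt_irrefl _ this
    simp only [Finset.mem_coe, Finset.mem_powersetCard] at *
    refine ⟨fun c hc => ?_, ?_⟩
    · simp only [Finset.mem_erase] at hc
      exact Finset.mem_filter.2 ⟨hQP hc.2.2, h c hc.2.2 hc.2.1 hc.1⟩
    · rw [Finset.card_erase_of_mem (Finset.mem_erase.2 ⟨hab, hb⟩), Finset.card_erase_of_mem ha]
      omega
  · intro Q hQ Q' hQ' h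
    have hQ := (Finset.mem_filter.1 hQ).2
    have hQ' := (Finset.mem_filter.1 hQ').2
    ext c
    by_cases hca : c = a
    · subst hca
      exact iff_of_true hQ.1 hQ'.1
    by_cases hcb : c = b
    · subst hcb
      exact iff_of_true hQ.2.1 hQ'.2.1
    · have := Finset.ext_iff.1 h c
      simpa [hca, hcb] using this

open Classical in
lemma crNum_eq_card (P : Finset (ℝ × ℝ)) :
    crNum P = ((P.powersetCard 4).filter fun Q : Finset (ℝ × ℝ) =>
      ConvexPos (Q : Set (ℝ × ℝ))).card := by
  rw [crNum, ← Set.ncard_coe_finset]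
  congr 1
  ext Q
  simp [Finset.mem_powersetCard, and_assoc]

/-- The number of convex quadrilaterals of a point set in general position is bounded in terms of
the numbers of points on the left of the lines spanned by pairs of points. -/
lemma crNum_add_le (P : Finset (ℝ × ℝ))
    (h : ∀ a ∈ P, ∀ b ∈ P, ∀ c ∈ P, a ≠ b → a ≠ c → b ≠ c → orient a b c ≠ 0) :
    crNum P + 3 * P.card.choose 4 ≤ ∑ a ∈ P, ∑ b ∈ P, (numLeft P a b).choose 2 := by
  classical
  refine le_trans ?_ (sum_hullEdges_le P)
  rw [crNum_eq_card, Finset.card_filter, ← Finset.card_powersetCard, mul_comm, ← smul_eq_mul,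
    ← Finset.sum_const, ← Finset.sum_add_distrib]
  refine Finset.sum_le_sum fun Q hQ => ?_
  obtain ⟨hQP, hQ⟩ := Finset.mem_powersetCard.1 hQ
  rw [add_comm]
  exact hullEdges_four hQ fun a ha b hb c hc => h a (hQP ha) b (hQP hb) c (hQP hc)

/-- The positive part of the orientation determinant of three lattice points. -/
def detPos (a b c : ℕ × ℕ) : ℕ := a.1 * b.2 + b.1 * c.2 + c.1 * a.2

/-- The negative part of the orientation determinant of three lattice points. -/
def detNeg (a b c : ℕ × ℕ) : ℕ := a.2 * b.1 + b.2 * c.1 + c.2 * a.1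

/-- The number whose base `2 ^ (w + 1)` digits are the values of `f` along a list. -/
def pack (w : ℕ) (f : ℕ × ℕ → ℕ) : List (ℕ × ℕ) → ℕ
  | [] => 0
  | c :: l => f c + 2 ^ (w + 1) * pack w f l

/-- The packed orientation determinants `2 ^ w + det (a, b, c)` for all `c` in a list, computed
from the packed list `o` of ones and the packed coordinates `x`, `y`. -/
def packedDet (w o x y : ℕ) (a b : ℕ × ℕ) : ℕ :=
  (a.1 * b.2 + 2 ^ w) * o + b.1 * y + a.2 * x - (a.2 * b.1 * o + b.2 * x + a.1 * y)

/-- The number of packed entries whose bit `w` is set. -/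
def packedCount (w o z : ℕ) : ℕ := ((z &&& 2 ^ w * o) / 2 ^ w) % (2 ^ (w + 1) - 1)

/-- The number of `c` in the list `l` for which the triangle `a b c` is not clockwise, computed by
arithmetic on packed numbers. -/
def leftCount (w : ℕ) (l : List (ℕ × ℕ)) (a b : ℕ × ℕ) : ℕ :=
  packedCount w (pack w (fun _ => 1) l)
    (packedDet w (pack w (fun _ => 1) l) (pack w Prod.fst l) (pack w Prod.snd l) a b)

lemma pack_add (w : ℕ) (f g : ℕ × ℕ → ℕ) (l : List (ℕ × ℕ)) :
    pack w (fun c => f c + g c) l = pack w f l + pack w g l := by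
  induction l with
  | nil => rfl
  | cons c l ih => simp only [pack, ih]; ring

lemma pack_mul (w k : ℕ) (f : ℕ × ℕ → ℕ) (l : List (ℕ × ℕ)) :
    pack w (fun c => k * f c) l = k * pack w f l := by
  induction l with
  | nil => rfl
  | cons c l ih => simp only [pack, ih]; ring

lemma pack_congr (w : ℕ) {f g : ℕ × ℕ → ℕ} {l : List (ℕ × ℕ)} (h : ∀ c ∈ l, f c = g c) :
    pack w f l = pack w g l := by
  induction l with
  | nil => rfl
  | cons c l ih =>
    simp only [pack]
    rw [h c (by simp), ih fun d hd => h d (by simp [hd])]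

lemma pack_mono (w : ℕ) {f g : ℕ × ℕ → ℕ} {l : List (ℕ × ℕ)} (h : ∀ c ∈ l, f c ≤ g c) :
    pack w f l ≤ pack w g l := by
  induction l with
  | nil => rfl
  | cons c l ih =>
    simp only [pack]
    have := h c (by simp)
    have := ih fun d hd => h d (by simp [hd])
    gcongr

lemma pack_modEq (w : ℕ) (f : ℕ × ℕ → ℕ) (l : List (ℕ × ℕ)) :
    pack w f l ≡ (l.map f).sum [MOD 2 ^ (w + 1) - 1] := by
  induction l with
  | nil => rfl
  | cons c l ih =>
    simp only [pack, List.map_cons, List.sum_cons]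
    refine Nat.ModEq.add_left _ ?_
    have h : 2 ^ (w + 1) ≡ 1 [MOD 2 ^ (w + 1) - 1] :=
      (Nat.modEq_iff_dvd' Nat.one_le_two_pow).2 dvd_rfl |>.symm
    simpa using h.mul ih

lemma and_pack (w : ℕ) (f : ℕ × ℕ → ℕ) (l : List (ℕ × ℕ)) (h : ∀ c ∈ l, f c < 2 ^ (w + 1)) :
    pack w f l &&& 2 ^ w * pack w (fun _ => 1) l =
      2 ^ w * pack w (fun c => if 2 ^ w ≤ f c then 1 else 0) l := by
  induction l with
  | nil => simp [pack]
  | cons c l ih =>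
    have ih := ih fun d hd => h d (by simp [hd])
    have hc := h c (by simp)
    have hw : 2 ^ w < 2 ^ (w + 1) := Nat.pow_lt_pow_right (by norm_num) (by omega)
    have hand : f c &&& 2 ^ w = 2 ^ w * (if 2 ^ w ≤ f c then 1 else 0) := by
      rw [Nat.and_two_pow]
      split_ifs with hle
      · rw [Nat.testBit_eq_decide_div_mod_eq]
        have : f c / 2 ^ w = 1 := by
          rw [Nat.div_eq_iff (by positivity)]
          rw [pow_succ] at hc
          omega
        simp [this]
      · simp [Nat.testBit_lt_two_pow (not_le.1 hle)]
    simp only [pack]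
    rw [← Nat.mod_add_div (_ &&& _) (2 ^ (w + 1)), Nat.and_mod_two_pow, Nat.and_div_two_pow]
    have e : 2 ^ w * (1 + 2 ^ (w + 1) * pack w (fun _ => 1) l) =
        2 ^ w + 2 ^ (w + 1) * (2 ^ w * pack w (fun _ => 1) l) := by ring
    rw [e, Nat.add_mul_mod_self_left, Nat.add_mul_mod_self_left, Nat.mod_eq_of_lt hc,
      Nat.mod_eq_of_lt hw, Nat.add_mul_div_left _ _ (by positivity),
      Nat.add_mul_div_left _ _ (by positivity), Nat.div_eq_of_lt hc, Nat.div_eq_of_lt hw,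
      zero_add, zero_add, ih, hand]
    ring

lemma packedCount_pack (w : ℕ) (f : ℕ × ℕ → ℕ) (l : List (ℕ × ℕ)) (h : ∀ c ∈ l, f c < 2 ^ (w + 1))
    (hl : l.length < 2 ^ (w + 1) - 1) :
    packedCount w (pack w (fun _ => 1) l) (pack w f l) = l.countP fun c => 2 ^ w ≤ f c := by
  have hs : (l.map fun c => if 2 ^ w ≤ f c then 1 else 0).sum =
      l.countP fun c => 2 ^ w ≤ f c := by
    clear h hl
    induction l with
    | nil => rfl
    | cons c l ih => simp [List.countP_cons, ih, add_comm]
  rw [packedCount, and_pack w f l h, Nat.mul_div_cancel_left _ (by positivity),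
    pack_modEq w _ l, hs, Nat.mod_eq_of_lt (lt_of_le_of_lt List.countP_le_length hl)]

lemma packedDet_pack (w : ℕ) (l : List (ℕ × ℕ)) (a b : ℕ × ℕ)
    (h : ∀ c ∈ l, detNeg a b c ≤ 2 ^ w) :
    packedDet w (pack w (fun _ => 1) l) (pack w Prod.fst l) (pack w Prod.snd l) a b =
      pack w (fun c => 2 ^ w + detPos a b c - detNeg a b c) l := by
  rw [packedDet, Nat.sub_eq_iff_eq_add']
  · simp only [← pack_mul, ← pack_add]
    refine pack_congr w fun c hc => ?_
    have := h c hc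
    simp only [detPos, detNeg] at *
    have e : a.1 * b.2 * 1 = a.1 * b.2 := mul_one _
    zify [show a.2 * b.1 + b.2 * c.1 + c.2 * a.1 ≤
      2 ^ w + (a.1 * b.2 + b.1 * c.2 + c.1 * a.2) by omega]
    ring
  · simp only [← pack_mul, ← pack_add]
    refine pack_mono w fun c hc => ?_
    have := h c hc
    simp only [detNeg] at this
    nlinarith

lemma leftCount_eq (w : ℕ) (l : List (ℕ × ℕ)) (a b : ℕ × ℕ)
    (hneg : ∀ c ∈ l, detNeg a b c ≤ 2 ^ w) (hpos : ∀ c ∈ l, detPos a b c < 2 ^ w)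
    (hl : l.length < 2 ^ (w + 1) - 1) :
    leftCount w l a b = l.countP fun c => detNeg a b c ≤ detPos a b c := by
  rw [leftCount, packedDet_pack w l a b hneg, packedCount_pack w _ l _ hl]
  · refine List.countP_congr fun c hc => ?_
    have := hneg c hc
    simp only [decide_eq_true_eq]
    omega
  · intro c hc
    have := hpos c hc
    rw [pow_succ]
    omega

/-- A list of 108 lattice points, each of them with a second point on a line through the first
one that splits the other 107 points into 53 points on its left and 54 points on its right. -/
def baseData : List ((ℕ × ℕ) × (ℕ × ℕ)) := [
  ((2099142186, 1787749438), (1265597427, 2464598490)),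
  ((1560193585, 2141884927), (2611985030, 2357885530)),
  ((1355308857, 2122662246), (2428993336, 2111565249)),
  ((2172431931, 1348115548), (2178916399, 274393304)),
  ((1929920076, 2064109312), (2990281306, 1895125390)),
  ((2090840555, 1801153841), (1547052282, 2727013344)),
  ((2715751272, 2717741394), (3411252042, 3535787960)),
  ((2593531966, 2642763049), (3059441419, 3610156395)),
  ((1363513524, 2123455981), (2428565621, 2259784755)),
  ((1360501130, 2123189380), (291195545, 2025685169)),
  ((1457465388, 2120504376), (385058882, 2174037459)),
  ((1623696456, 2116632725), (2640819713, 1772566183)),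
  ((1627058406, 2115277373), (656868369, 2575334758)),
  ((1652205229, 2098251916), (753080956, 2685190624)),
  ((1863079013, 2206227950), (830374617, 1912215816)),
  ((1458500779, 2120462178), (387604346, 2198579614)),
  ((1344513671, 2122661562), (270818379, 2132657792)),
  ((1846801164, 2199951580), (905406460, 1683523932)),
  ((2099350791, 1786885161), (1877830109, 2837527865)),
  ((1547979316, 2139314546), (496188779, 1923309521)),
  ((1354704576, 2122674944), (2424159169, 2218530969)),
  ((2172162994, 1373271970), (2214864961, 300379596)),
  ((1929891057, 2064113662), (869529677, 2233096642)),
  ((2089044282, 1803792288), (2806275936, 1004730176)),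
  ((2715308150, 2717247342), (2078506061, 1852721689)),
  ((2584689835, 2624269047), (2125694060, 1653576313)),
  ((1362529999, 2123383247), (290573009, 2061498545)),
  ((1343082270, 2122656729), (2416664916, 2141144773)),
  ((1458282586, 2120481104), (2529177917, 2042348562)),
  ((1625193479, 2116282617), (2662898664, 1840439447)),
  ((1626485190, 2115578806), (2596326006, 1654785690)),
  ((1658914690, 2101754033), (2725496225, 1977958498)),
  ((1861519666, 2205614047), (2832378932, 2664257470)),
  ((1453978506, 2120616186), (2527345809, 2092258854)),
  ((1343673224, 2122661258), (270112497, 2102941451)),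
  ((1846805398, 2199953793), (918297473, 1660700107)),
  ((2507217858, 2458876396), (2068314284, 1478934991)),
  ((2153082369, 1565792306), (1884400696, 2605374753)),
  ((2172305050, 1380130259), (2183175986, 2453817051)),
  ((2946851748, 2971800031), (3703812699, 3733332449)),
  ((2230857984, 2013294412), (2377021644, 3077041416)),
  ((2493813455, 2437170362), (2898656079, 3431667197)),
  ((1577225902, 2145493526), (515126683, 1987801567)),
  ((1652204247, 2098252565), (2551328635, 1511314034)),
  ((2171511315, 1387541191), (2014642961, 2449762366)),
  ((2171777916, 1384795398), (2278980106, 316418500)),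
  ((2174462920, 1484444660), (2123546349, 411910741)),
  ((2178334571, 1654547379), (2440983967, 2695670234)),
  ((2179689923, 1659264681), (1851363328, 636952032)),
  ((2196715380, 1701436961), (1802284222, 702765060)),
  ((2088739346, 1804334711), (2494690076, 810289687)),
  ((2174505118, 1485522249), (2101834805, 414242393)),
  ((2172305734, 1369335757), (2162493439, 295638768)),
  ((2095015716, 1794333232), (2924338143, 1112317238)),
  ((2508082135, 2459949278), (1824252945, 1632121310)),
  ((2155652750, 1556148418), (2424338462, 516567015)),
  ((2172292352, 1379513280), (2067084301, 2448088392)),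
  ((2921695326, 2946374672), (3665991358, 3720289992)),
  ((2230853634, 2013261043), (2084690671, 949513943)),
  ((2491175008, 2432735642), (2991420462, 3382828264)),
  ((1577719954, 2145544456), (2616496932, 2417323584)),
  ((1670698249, 2107904436), (613726708, 2296935296)),
  ((2171584049, 1386630400), (2237578163, 314918554)),
  ((2172310567, 1367909189), (2153395452, 2441484395)),
  ((2174486192, 1485285130), (2247169979, 2556564072)),
  ((2178684679, 1656394510), (2398920825, 2707307230)),
  ((2179388490, 1658390032), (2508128896, 2680569688)),
  ((2193213263, 1704644305), (2303899749, 2772665843)),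
  ((2089353249, 1803389267), (1371889778, 2602243242)),
  ((2174351110, 1480845968), (2201977825, 2554232324)),
  ((2172306038, 1368495614), (2192524647, 294944166)),
  ((2095013503, 1794335253), (2965636936, 1165895644)),
  ((1836090900, 2195825110), (2776212214, 2714567261)),
  ((2729174990, 2734773711), (2061169862, 1894124763)),
  ((2914837037, 2939658439), (2151713374, 2184301715)),
  ((1323167265, 2122535365), (249444787, 2116089830)),
  ((2281672884, 2365047220), (1468609285, 1663727686)),
  ((1857796934, 2204126741), (2864817714, 2576726597)),
  ((2149473770, 1579216024), (2337108870, 521995813)),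
  ((2196714731, 1701435330), (2983345550, 970590983)),
  ((2907426105, 2931453772), (2201917148, 2122022728)),
  ((2910171898, 2934466166), (3632327416, 3729081112)),
  ((2810522636, 2837501908), (3588017855, 3578057570)),
  ((2640419917, 2671270840), (1780346780, 2028467834)),
  ((2635702615, 2667908890), (3524256920, 3270729553)),
  ((2593530335, 2642762067), (3512208394, 3198596691)),
  ((2490632585, 2431888283), (3113019754, 3306848692)),
  ((2809445047, 2836466517), (3594899049, 3568575468)),
  ((2925631539, 2950453625), (3688375312, 3706193952)),
  ((2500634064, 2448166132), (2941973707, 3427012813)),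
  ((1835018018, 2195616505), (2892925304, 2379338248)),
  ((2738818878, 2746987980), (3406822329, 3587638261)),
  ((2915454016, 2940262720), (2192621757, 2146263331)),
  ((1348592624, 2122804302), (275636081, 2081746288)),
  ((2281706253, 2365076239), (3094769581, 3066396087)),
  ((1862231654, 2205923014), (891319642, 1747391259)),
  ((2149422840, 1579659146), (1786678269, 2590271772)),
  ((2187062860, 1710277461), (1387782422, 2427265805)),
  ((2908336896, 2932437297), (3644633902, 3713966711)),
  ((2927058107, 2951885026), (2174449034, 2186051436)),
  ((2809682166, 2836684710), (2024223280, 2104580999)),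
  ((2638572786, 2669773817), (1796090845, 2004081933)),
  ((2636577264, 2668482106), (1747844895, 2065923992)),
  ((2590322991, 2636052606), (1790692939, 1919454194)),
  ((2491578029, 2433447630), (1991443956, 1483296372)),
  ((2814121328, 2840988790), (2045038200, 2091700697)),
  ((2926471682, 2951294072), (3678628490, 3717571855)),
  ((2500632043, 2448161898), (2915745771, 3438415450))]

/-- A set of 108 lattice points with few convex quadrilaterals. -/
def basePoints : List (ℕ × ℕ) := baseData.map Prod.fst

set_option maxRecDepth 100000 in
lemma length_basePoints : basePoints.length = 108 := by decide +kernel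

set_option maxRecDepth 100000 in
lemma nodup_basePoints : basePoints.Nodup := by decide +kernel

set_option maxRecDepth 100000 in
lemma baseData_lt : ∀ d ∈ baseData,
    d.1.1 < 2 ^ 32 ∧ d.1.2 < 2 ^ 32 ∧ d.2.1 < 2 ^ 32 ∧ d.2.2 < 2 ^ 32 := by decide +kernel

set_option maxRecDepth 100000 in
lemma leftCount_baseData : ∀ d ∈ baseData, leftCount 71 basePoints d.1 d.2 = 54 ∧
    leftCount 71 basePoints d.2 d.1 = 55 := by decide +kernel

set_option maxRecDepth 100000 in
lemma leftCount_add_leftCount_basePoints : ∀ a ∈ basePoints, ∀ b ∈ basePoints, a = b ∨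
    leftCount 71 basePoints a b + leftCount 71 basePoints b a = 110 := by decide +kernel

set_option maxRecDepth 100000 in
lemma sum_leftCount_basePoints : (basePoints.map fun a => (basePoints.map fun b =>
    leftCount 71 basePoints a b * (leftCount 71 basePoints a b - 2)).sum).sum = 39233874 := by
  decide +kernel

/-- A finite planar point set in general position, together with a halving line through each of
its points. -/
structure HalvedConfig (ι : Type*) [Fintype ι] where
  /-- The points. -/
  pt : ι → ℝ × ℝ
  /-- A second point on the halving line. -/
  pivot : ι → ℝ × ℝ
  /-- Half of the number of points. -/
  half : ℕ
  orient_ne : ∀ i j k, i ≠ j → i ≠ k → j ≠ k → orient (pt i) (pt j) (pt k) ≠ 0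
  orient_pivot_ne : ∀ i j, j ≠ i → orient (pt i) (pivot i) (pt j) ≠ 0
  card_left : ∀ i, (Finset.univ.filter fun j => 0 < orient (pt i) (pivot i) (pt j)).card + 1 ≤ half
  card_right : ∀ i, (Finset.univ.filter fun j => orient (pt i) (pivot i) (pt j) < 0).card ≤ half

/-- The number of points of an indexed family to the left of the ray from one of them to
another. -/
noncomputable def leftDegree {ι : Type*} [Fintype ι] (p : ι → ℝ × ℝ) (i j : ι) : ℕ :=
  (Finset.univ.filter fun k => 0 < orient (p i) (p j) (p k)).card

lemma leftDegree_self {ι : Type*} [Fintype ι] (p : ι → ℝ × ℝ) (i : ι) : leftDegree p i i = 0 := by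
  simp [leftDegree, orient_self]

/-- The inclusion of lattice points in the plane. -/
def toPlane (a : ℕ × ℕ) : ℝ × ℝ := (a.1, a.2)

lemma orient_toPlane (a b c : ℕ × ℕ) :
    orient (toPlane a) (toPlane b) (toPlane c) = (detPos a b c : ℝ) - detNeg a b c := by
  simp only [orient, toPlane, detPos, detNeg]
  push_cast
  ring

lemma countP_eq_card_filter {α : Type*} (l : List α) (P : α → Prop) [DecidablePred P] :
    l.countP (fun a => P a) = (Finset.univ.filter fun i : Fin l.length => P l[i.1]).card := by
  rw [Finset.card_filter, Fin.sum_univ_fun_getElem l fun a => if P a then 1 else 0]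
  induction l with
  | nil => rfl
  | cons c l ih => simp [List.countP_cons, ih, add_comm]

/-- The number of indices of basePoints that are not to the right of the ray from `a` to `b`. -/
lemma leftCount_eq_card (a b : ℕ × ℕ) (ha : a.1 < 2 ^ 32 ∧ a.2 < 2 ^ 32)
    (hb : b.1 < 2 ^ 32 ∧ b.2 < 2 ^ 32) :
    leftCount 71 basePoints a b = (Finset.univ.filter fun k : Fin basePoints.length =>
      0 ≤ orient (toPlane a) (toPlane b) (toPlane basePoints[k.1])).card := by
  have key : ∀ c ∈ basePoints, c.1 < 2 ^ 32 ∧ c.2 < 2 ^ 32 := by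
    intro c hc
    obtain ⟨d, hd, rfl⟩ := List.mem_map.1 hc
    have := baseData_lt d hd
    exact ⟨this.1, this.2.1⟩
  have bound : ∀ x y : ℕ, x < 2 ^ 32 → y < 2 ^ 32 → x * y ≤ 2 ^ 64 := by
    intro x y hx hy
    calc x * y ≤ 2 ^ 32 * 2 ^ 32 := Nat.mul_le_mul hx.le hy.le
      _ = 2 ^ 64 := by norm_num
  rw [leftCount_eq, countP_eq_card_filter]
  · congr 1
    refine Finset.filter_congr fun k _ => ?_
    rw [orient_toPlane, sub_nonneg, Nat.cast_le]
  · intro c hc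
    have hc := key c hc
    have h₁ := bound _ _ ha.2 hb.1
    have h₂ := bound _ _ hb.2 hc.1
    have h₃ := bound _ _ hc.2 ha.1
    rw [detNeg]
    omega
  · intro c hc
    have hc := key c hc
    have h₁ := bound _ _ ha.1 hb.2
    have h₂ := bound _ _ hb.1 hc.2
    have h₃ := bound _ _ hc.1 ha.2
    rw [detPos]
    omega
  · rw [length_basePoints]
    norm_num

lemma card_nonneg_eq {ι : Type*} [Fintype ι] (f : ι → ℝ) :
    (Finset.univ.filter fun k => 0 ≤ f k).card =
      (Finset.univ.filter fun k => 0 < f k).card + (Finset.univ.filter fun k => f k = 0).card := by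
  simp only [Finset.card_filter, ← Finset.sum_add_distrib]
  refine Finset.sum_congr rfl fun k _ => ?_
  rcases lt_trichotomy (f k) 0 with h | h | h
  · simp [h.not_ge, h.not_gt, h.ne]
  · simp [h]
  · simp [h.le, h, h.ne']

lemma card_add_card_eq {ι : Type*} [Fintype ι] (f : ι → ℝ) :
    (Finset.univ.filter fun k => 0 ≤ f k).card + (Finset.univ.filter fun k => 0 ≤ -f k).card =
      Fintype.card ι + (Finset.univ.filter fun k => f k = 0).card := by
  rw [← Finset.card_univ, Finset.card_eq_sum_ones (Finset.univ : Finset ι)]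
  simp only [Finset.card_filter, ← Finset.sum_add_distrib]
  refine Finset.sum_congr rfl fun k _ => ?_
  rcases lt_trichotomy (f k) 0 with h | h | h
  · simp [h.not_ge, h.le, h.ne]
  · simp [h]
  · simp [h.le, h, h.ne']

lemma basePoints_getElem_lt (i : Fin basePoints.length) :
    basePoints[i.1].1 < 2 ^ 32 ∧ basePoints[i.1].2 < 2 ^ 32 := by
  obtain ⟨d, hd, h⟩ := List.mem_map.1 (List.getElem_mem i.2 : basePoints[i.1] ∈ basePoints)
  have := baseData_lt d hd
  rw [← h]
  exact ⟨this.1, this.2.1⟩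

lemma card_orient_eq_zero (i j : Fin basePoints.length) (hij : i ≠ j) :
    (Finset.univ.filter fun k : Fin basePoints.length => orient (toPlane basePoints[i.1])
      (toPlane basePoints[j.1]) (toPlane basePoints[k.1]) = 0) = {i, j} := by
  symm
  refine Finset.eq_of_subset_of_card_le ?_ ?_
  · simp [Finset.insert_subset_iff, orient_self_left, orient_self_right]
  · have h := leftCount_add_leftCount_basePoints _ (List.getElem_mem i.2) _ (List.getElem_mem j.2)
    have hne : basePoints[i.1] ≠ basePoints[j.1] := fun h =>
      hij (Fin.ext ((nodup_basePoints.getElem_inj_iff).1 h))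
    have h := h.resolve_left hne
    rw [leftCount_eq_card _ _ (basePoints_getElem_lt i) (basePoints_getElem_lt j),
      leftCount_eq_card _ _ (basePoints_getElem_lt j) (basePoints_getElem_lt i)] at h
    simp only [orient_swap (toPlane basePoints[i.1])] at h
    have h' := card_add_card_eq fun k : Fin basePoints.length => orient (toPlane basePoints[i.1])
      (toPlane basePoints[j.1]) (toPlane basePoints[k.1])
    have hcard : Fintype.card (Fin basePoints.length) = 108 := by
      rw [Fintype.card_fin, length_basePoints]
    rw [hcard] at h'
    rw [Finset.card_pair hij]
    omega

lemma leftCount_eq_leftDegree_add (i j : Fin basePoints.length) (hij : i ≠ j) :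
    leftCount 71 basePoints basePoints[i.1] basePoints[j.1] =
      leftDegree (fun k : Fin basePoints.length => toPlane basePoints[k.1]) i j + 2 := by
  rw [leftCount_eq_card _ _ (basePoints_getElem_lt i) (basePoints_getElem_lt j), card_nonneg_eq,
    card_orient_eq_zero i j hij, Finset.card_pair hij]
  rfl

lemma leftCount_self_basePoints (i : Fin basePoints.length) :
    leftCount 71 basePoints basePoints[i.1] basePoints[i.1] = 108 := by
  rw [leftCount_eq_card _ _ (basePoints_getElem_lt i) (basePoints_getElem_lt i)]
  simp [orient_self, length_basePoints]

/-- The second points on the halving lines of `basePoints`. -/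
def basePivot (i : Fin basePoints.length) : ℕ × ℕ :=
  (baseData[i.1]'(by simpa [basePoints] using i.2)).2

lemma basePivot_spec (i : Fin basePoints.length) :
    (basePivot i).1 < 2 ^ 32 ∧ (basePivot i).2 < 2 ^ 32 ∧
      leftCount 71 basePoints basePoints[i.1] (basePivot i) = 54 ∧
      leftCount 71 basePoints (basePivot i) basePoints[i.1] = 55 := by
  have e : basePoints[i.1] = (baseData[i.1]'(by simpa [basePoints] using i.2)).1 := by
    simp [basePoints]
  have hi : i.1 < baseData.length := by simpa [basePoints] using i.2
  have h := baseData_lt _ (List.getElem_mem hi)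
  have h' := leftCount_baseData _ (List.getElem_mem hi)
  rw [e]
  exact ⟨h.2.2.1, h.2.2.2, h'⟩

lemma basePivot_cards (i : Fin basePoints.length) :
    (Finset.univ.filter fun k : Fin basePoints.length => orient (toPlane basePoints[i.1])
      (toPlane (basePivot i)) (toPlane basePoints[k.1]) = 0) = {i} ∧
    (Finset.univ.filter fun k : Fin basePoints.length => 0 < orient (toPlane basePoints[i.1])
      (toPlane (basePivot i)) (toPlane basePoints[k.1])).card = 53 ∧
    (Finset.univ.filter fun k : Fin basePoints.length => orient (toPlane basePoints[i.1])
      (toPlane (basePivot i)) (toPlane basePoints[k.1]) < 0).card = 54 := by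
  obtain ⟨h₁, h₂, h₃, h₄⟩ := basePivot_spec i
  rw [leftCount_eq_card _ _ (basePoints_getElem_lt i) ⟨h₁, h₂⟩] at h₃
  rw [leftCount_eq_card _ _ ⟨h₁, h₂⟩ (basePoints_getElem_lt i)] at h₄
  simp only [orient_swap (toPlane basePoints[i.1])] at h₄
  set f : Fin basePoints.length → ℝ := fun k => orient (toPlane basePoints[i.1])
    (toPlane (basePivot i)) (toPlane basePoints[k.1]) with hf
  have h : _ = Fintype.card (Fin basePoints.length) + _ := card_add_card_eq f
  have hpos := card_nonneg_eq f
  have hneg := card_nonneg_eq fun k => -f k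
  simp only [neg_eq_zero, Left.neg_pos_iff] at hneg
  have hcard : Fintype.card (Fin basePoints.length) = 108 := by
    rw [Fintype.card_fin, length_basePoints]
  change (Finset.univ.filter fun k => 0 ≤ f k).card = 54 at h₃
  change (Finset.univ.filter fun k => 0 ≤ -f k).card = 55 at h₄
  rw [hcard] at h
  refine ⟨?_, ?_, ?_⟩
  · symm
    refine Finset.eq_of_subset_of_card_le ?_ ?_
    · simp [orient_self_left]
    · rw [Finset.card_singleton]
      change (Finset.univ.filter fun k => f k = 0).card ≤ 1
      omega
  · change (Finset.univ.filter fun k => 0 < f k).card = 53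
    omega
  · change (Finset.univ.filter fun k => f k < 0).card = 54
    omega

/-- The point set `basePoints` with its halving lines. -/
def baseConfig : HalvedConfig (Fin basePoints.length) where
  pt k := toPlane basePoints[k.1]
  pivot k := toPlane (basePivot k)
  half := 54
  orient_ne i j k hij hik hjk h := by
    have : k ∈ ({i, j} : Finset (Fin basePoints.length)) := by
      rw [← card_orient_eq_zero i j hij]
      simpa using h
    simp only [Finset.mem_insert, Finset.mem_singleton] at this
    exact this.elim (fun h => hik h.symm) fun h => hjk h.symm
  orient_pivot_ne i j hji h := by
    have : j ∈ ({i} : Finset (Fin basePoints.length)) := by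
      rw [← (basePivot_cards i).1]
      simpa using h
    exact hji (Finset.mem_singleton.1 this)
  card_left i := by rw [(basePivot_cards i).2.1]
  card_right i := (basePivot_cards i).2.2.le

lemma sum_leftDegree_baseConfig :
    ∑ i, ∑ j, leftDegree baseConfig.pt i j * (leftDegree baseConfig.pt i j + 2) = 37997490 := by
  have h := sum_leftCount_basePoints
  rw [← Fin.sum_univ_fun_getElem] at h
  simp only [← Fin.sum_univ_fun_getElem basePoints] at h
  have key : ∀ i j : Fin basePoints.length,
      leftCount 71 basePoints basePoints[i.1] basePoints[j.1] *
        (leftCount 71 basePoints basePoints[i.1] basePoints[j.1] - 2) =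
      leftDegree baseConfig.pt i j * (leftDegree baseConfig.pt i j + 2) +
        if i = j then 108 * 106 else 0 := by
    intro i j
    rcases eq_or_ne i j with rfl | hij
    · rw [leftDegree_self]
      have := leftCount_self_basePoints i
      simp [this]
    · have := leftCount_eq_leftDegree_add i j hij
      rw [this, if_neg hij]
      simp only [baseConfig]
      rw [Nat.add_sub_cancel]
      ring
  simp only [key, Finset.sum_add_distrib, Finset.sum_ite_eq, Finset.mem_univ, if_true,
    Finset.sum_const, Finset.card_univ, Fintype.card_fin, length_basePoints] at h
  exact Nat.add_right_cancel (h.trans (by norm_num : _ = 37997490 + 108 • (108 * 106)))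

/-- The point `p` moved to the parameter `t` on a small parabola with tangent vector `v` at `p`. -/
def parabola (p v : ℝ × ℝ) (t : ℝ) : ℝ × ℝ :=
  (p.1 + t * v.1 - t ^ 2 * v.2, p.2 + t * v.2 + t ^ 2 * v.1)

/-- The blow-up of a configuration, in which each point is replaced by points on a small
parabola that is tangent to its halving line. -/
def HalvedConfig.blowup {ι : Type*} [Fintype ι] (C : HalvedConfig ι) (m : ℕ) (ε : ℝ)
    (x : ι × Fin m) : ℝ × ℝ :=
  parabola (C.pt x.1) (C.pivot x.1 - C.pt x.1) (ε * (x.2 : ℕ))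

/-- The orientations of triples of a family of points are those of an infinitesimal blow-up of a
configuration. -/
structure IsBlowup {ι : Type*} [Fintype ι] (C : HalvedConfig ι) (m : ℕ)
    (q : ι × Fin m → ℝ × ℝ) : Prop where
  distinct : ∀ i j r k l s, i ≠ j → i ≠ r → j ≠ r →
    (0 < orient (q (i, k)) (q (j, l)) (q (r, s)) ↔ 0 < orient (C.pt i) (C.pt j) (C.pt r)) ∧
      orient (q (i, k)) (q (j, l)) (q (r, s)) ≠ 0
  pair : ∀ i j k l s, i ≠ j → k ≠ l →
    (0 < orient (q (i, k)) (q (i, l)) (q (j, s)) ↔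
      (k < l ↔ 0 < orient (C.pt i) (C.pivot i) (C.pt j))) ∧
      orient (q (i, k)) (q (i, l)) (q (j, s)) ≠ 0
  cluster : ∀ i k l s, k ≠ l → k ≠ s → l ≠ s →
    (0 < orient (q (i, k)) (q (i, l)) (q (i, s)) ↔
      0 < ((l : ℕ) - (k : ℕ) : ℝ) * ((s : ℕ) - (k : ℕ)) * ((s : ℕ) - (l : ℕ))) ∧
      orient (q (i, k)) (q (i, l)) (q (i, s)) ≠ 0

lemma eventually_sign {f : ℝ → ℝ} (hf : Continuous f) (h : f 0 ≠ 0) :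
    ∀ᶠ ε in nhdsWithin (0 : ℝ) (Set.Ioi 0), (0 < f ε ↔ 0 < f 0) ∧ f ε ≠ 0 := by
  have ht : Filter.Tendsto f (nhdsWithin (0 : ℝ) (Set.Ioi 0)) (nhds (f 0)) :=
    hf.continuousAt.tendsto.mono_left nhdsWithin_le_nhds
  rcases h.lt_or_gt with h | h
  · filter_upwards [ht.eventually_lt_const h] with ε hε
    exact ⟨iff_of_false hε.not_gt h.not_gt, hε.ne⟩
  · filter_upwards [ht.eventually_const_lt h] with ε hε
    exact ⟨iff_of_true hε h, hε.ne'⟩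

lemma orient_parabola_pair (p v z : ℝ × ℝ) (s t : ℝ) :
    orient (parabola p v s) (parabola p v t) z = (t - s) *
      ((v.1 - (s + t) * v.2) * (z.2 - (parabola p v s).2) -
        (v.2 + (s + t) * v.1) * (z.1 - (parabola p v s).1)) := by
  simp only [orient, parabola]
  ring

lemma orient_parabola (p v : ℝ × ℝ) (r s t : ℝ) :
    orient (parabola p v r) (parabola p v s) (parabola p v t) =
      (v.1 ^ 2 + v.2 ^ 2) * ((s - r) * (t - r) * (t - s)) := by
  simp only [orient, parabola]
  ring

lemma exists_isBlowup {ι : Type*} [Fintype ι] [Nontrivial ι] (C : HalvedConfig ι) (m : ℕ) :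
    ∃ q, IsBlowup C m q := by
  have hcont : ∀ x : ι × Fin m, Continuous fun ε => C.blowup m ε x := by
    intro x
    unfold HalvedConfig.blowup parabola
    fun_prop
  have hzero : ∀ x : ι × Fin m, C.blowup m 0 x = C.pt x.1 := by
    intro x
    simp [HalvedConfig.blowup, parabola]
  have h₁ : ∀ᶠ ε in nhdsWithin (0 : ℝ) (Set.Ioi 0), ∀ i j r k l s, i ≠ j → i ≠ r → j ≠ r →
      (0 < orient (C.blowup m ε (i, k)) (C.blowup m ε (j, l)) (C.blowup m ε (r, s)) ↔
        0 < orient (C.pt i) (C.pt j) (C.pt r)) ∧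
      orient (C.blowup m ε (i, k)) (C.blowup m ε (j, l)) (C.blowup m ε (r, s)) ≠ 0 := by
    simp only [Filter.eventually_all]
    intro i j r k l s hij hir hjr
    have := eventually_sign (f := fun ε =>
      orient (C.blowup m ε (i, k)) (C.blowup m ε (j, l)) (C.blowup m ε (r, s)))
      (by
        have := hcont (i, k)
        have := hcont (j, l)
        have := hcont (r, s)
        unfold orient
        fun_prop)
      (by
        simp only [hzero]
        exact C.orient_ne i j r hij hir hjr)
    simpa only [hzero] using this
  have h₂ : ∀ᶠ ε in nhdsWithin (0 : ℝ) (Set.Ioi 0), ∀ i j k l s, i ≠ j → k ≠ l →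
      (0 < orient (C.blowup m ε (i, k)) (C.blowup m ε (i, l)) (C.blowup m ε (j, s)) ↔
        (k < l ↔ 0 < orient (C.pt i) (C.pivot i) (C.pt j))) ∧
      orient (C.blowup m ε (i, k)) (C.blowup m ε (i, l)) (C.blowup m ε (j, s)) ≠ 0 := by
    simp only [Filter.eventually_all]
    intro i j k l s hij hkl
    set v := C.pivot i - C.pt i with hv
    set G : ℝ → ℝ := fun ε =>
      (v.1 - (ε * (k : ℕ) + ε * (l : ℕ)) * v.2) *
        ((C.blowup m ε (j, s)).2 - (C.blowup m ε (i, k)).2) -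
      (v.2 + (ε * (k : ℕ) + ε * (l : ℕ)) * v.1) *
        ((C.blowup m ε (j, s)).1 - (C.blowup m ε (i, k)).1) with hG
    have hG₀ : G 0 = orient (C.pt i) (C.pivot i) (C.pt j) := by
      simp [hG, hzero, hv, orient]
    have hGc : Continuous G := by
      have := hcont (i, k)
      have := hcont (j, s)
      fun_prop
    have := eventually_sign hGc (by rw [hG₀]; exact C.orient_pivot_ne i j hij.symm)
    rw [hG₀] at this
    filter_upwards [this, self_mem_nhdsWithin] with ε h (hε : 0 < ε)
    have e : orient (C.blowup m ε (i, k)) (C.blowup m ε (i, l)) (C.blowup m ε (j, s)) =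
        ε * ((l : ℕ) - (k : ℕ)) * G ε := by
      rw [HalvedConfig.blowup, HalvedConfig.blowup, orient_parabola_pair, ← mul_sub]
      rfl
    rw [e, ← h.1]
    rcases hkl.lt_or_gt with hlt | hlt
    · have hpos : 0 < ε * ((l : ℕ) - (k : ℕ) : ℝ) := by
        have : ((k : ℕ) : ℝ) < (l : ℕ) := by exact_mod_cast hlt
        exact mul_pos hε (sub_pos.2 this)
      simp only [hlt, true_iff]
      exact ⟨mul_pos_iff_of_pos_left hpos, mul_ne_zero hpos.ne' h.2⟩
    · have hneg : ε * ((l : ℕ) - (k : ℕ) : ℝ) < 0 := by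
        have : ((l : ℕ) : ℝ) < (k : ℕ) := by exact_mod_cast hlt
        exact mul_neg_of_pos_of_neg hε (sub_neg.2 this)
      simp only [hlt.not_gt, false_iff, not_lt]
      refine ⟨?_, mul_ne_zero hneg.ne h.2⟩
      exact ⟨fun h' => (neg_of_mul_pos_right h' hneg.le).le,
        fun h' => mul_pos_of_neg_of_neg hneg (lt_of_le_of_ne h' h.2)⟩
  have h₃ : ∀ ε > 0, ∀ i k l s, k ≠ l → k ≠ s → l ≠ s →
      (0 < orient (C.blowup m ε (i, k)) (C.blowup m ε (i, l)) (C.blowup m ε (i, s)) ↔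
        0 < ((l : ℕ) - (k : ℕ) : ℝ) * ((s : ℕ) - (k : ℕ)) * ((s : ℕ) - (l : ℕ))) ∧
      orient (C.blowup m ε (i, k)) (C.blowup m ε (i, l)) (C.blowup m ε (i, s)) ≠ 0 := by
    intro ε hε i k l s hkl hks hls
    obtain ⟨j, hj⟩ := exists_ne i
    set v := C.pivot i - C.pt i with hv
    have hv₀ : 0 < v.1 ^ 2 + v.2 ^ 2 := by
      by_contra! hle
      have h₁ : v.1 = 0 := by nlinarith [sq_nonneg v.1, sq_nonneg v.2]
      have h₂ : v.2 = 0 := by nlinarith [sq_nonneg v.1, sq_nonneg v.2]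
      rw [hv, Prod.fst_sub] at h₁
      rw [hv, Prod.snd_sub] at h₂
      apply C.orient_pivot_ne i j hj
      rw [orient, h₁, h₂]
      ring
    have e : orient (C.blowup m ε (i, k)) (C.blowup m ε (i, l)) (C.blowup m ε (i, s)) =
        (v.1 ^ 2 + v.2 ^ 2) * ε ^ 3 *
          (((l : ℕ) - (k : ℕ)) * ((s : ℕ) - (k : ℕ)) * ((s : ℕ) - (l : ℕ))) := by
      simp only [HalvedConfig.blowup]
      rw [orient_parabola]
      ring
    have hpos : 0 < (v.1 ^ 2 + v.2 ^ 2) * ε ^ 3 := by positivity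
    have hsub : ∀ a b : Fin m, a ≠ b → ((b : ℕ) - (a : ℕ) : ℝ) ≠ 0 := by
      intro a b hab
      exact sub_ne_zero.2 (Nat.cast_injective.ne fun h => hab (Fin.ext h.symm))
    rw [e]
    exact ⟨mul_pos_iff_of_pos_left hpos, mul_ne_zero hpos.ne'
      (mul_ne_zero (mul_ne_zero (hsub k l hkl) (hsub k s hks)) (hsub l s hls))⟩
  obtain ⟨ε, ⟨h₁, h₂⟩, hε⟩ := ((h₁.and h₂).and self_mem_nhdsWithin).exists
  exact ⟨C.blowup m ε, h₁, h₂, h₃ ε hε⟩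

/-- The number of indices on a prescribed side of an index. -/
def sideRank {m : ℕ} (σ : Prop) [Decidable σ] (k : Fin m) : ℕ :=
  if σ then k else k.rev

lemma sum_cast_fin (m : ℕ) : ∑ k : Fin m, ((k : ℕ) : ℝ) = m * (m - 1) / 2 := by
  rw [Fin.sum_univ_eq_sum_range fun k : ℕ => (k : ℝ)]
  induction m with
  | zero => simp
  | succ m ih =>
    rw [Finset.sum_range_succ, ih]
    push_cast
    ring

lemma sum_cast_fin_sq (m : ℕ) :
    ∑ k : Fin m, ((k : ℕ) : ℝ) ^ 2 = m * (m - 1) * (2 * m - 1) / 6 := by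
  rw [Fin.sum_univ_eq_sum_range fun k : ℕ => (k : ℝ) ^ 2]
  induction m with
  | zero => simp
  | succ m ih =>
    rw [Finset.sum_range_succ, ih]
    push_cast
    ring

lemma sum_sideRank (m : ℕ) (σ : Prop) [Decidable σ] (f : ℝ → ℝ) :
    ∑ k : Fin m, f (sideRank σ k) = ∑ k : Fin m, f (k : ℕ) := by
  by_cases h : σ
  · simp [sideRank, h]
  · simp only [sideRank, h, if_false]
    exact Equiv.sum_comp Fin.revPerm fun k : Fin m => f (k : ℕ)

lemma card_filter_le_sideRank {m : ℕ} (σ : Prop) [Decidable σ] (k : Fin m) (p : Fin m → Prop)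
    [DecidablePred p] (h : ∀ s, p s → s ≠ k ∧ (s < k ↔ σ)) :
    (Finset.univ.filter p).card ≤ sideRank σ k := by
  by_cases hσ : σ
  · rw [sideRank, if_pos hσ, ← Fin.card_Iio]
    refine Finset.card_le_card fun s hs => ?_
    simp only [Finset.mem_filter, Finset.mem_univ, true_and] at hs
    exact Finset.mem_Iio.2 ((h s hs).2.2 hσ)
  · rw [sideRank, if_neg hσ, Fin.val_rev, add_comm, ← Nat.sub_sub, ← Fin.card_Ioi]
    refine Finset.card_le_card fun s hs => ?_
    simp only [Finset.mem_filter, Finset.mem_univ, true_and] at hs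
    exact Finset.mem_Ioi.2 (lt_of_le_of_ne (not_lt.1 fun h' => hσ ((h s hs).2.1 h'))
      (h s hs).1.symm)

lemma leftDegree_prod {ι κ : Type*} [Fintype ι] [Fintype κ] (q : ι × κ → ℝ × ℝ) (x y : ι × κ) :
    leftDegree q x y =
      ∑ r, (Finset.univ.filter fun s => 0 < orient (q x) (q y) (q (r, s))).card := by
  rw [leftDegree, Finset.card_filter, Fintype.sum_prod_type]
  simp only [Finset.card_filter]

section

variable {ι : Type*} [Fintype ι] {C : HalvedConfig ι} {m : ℕ} {q : ι × Fin m → ℝ × ℝ}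

open Classical in
lemma IsBlowup.leftDegree_le (hq : IsBlowup C m q) {i j : ι} (hij : i ≠ j) (k l : Fin m) :
    leftDegree q (i, k) (j, l) ≤ m * leftDegree C.pt i j +
      sideRank (0 < orient (C.pt i) (C.pivot i) (C.pt j)) k +
      sideRank (¬ 0 < orient (C.pt j) (C.pivot j) (C.pt i)) l := by
  have key : ∀ r, (Finset.univ.filter fun s =>
      0 < orient (q (i, k)) (q (j, l)) (q (r, s))).card ≤
      m * (if 0 < orient (C.pt i) (C.pt j) (C.pt r) then 1 else 0) +
      (if r = i then sideRank (0 < orient (C.pt i) (C.pivot i) (C.pt j)) k else 0) +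
      (if r = j then sideRank (¬ 0 < orient (C.pt j) (C.pivot j) (C.pt i)) l else 0) := by
    intro r
    by_cases hri : r = i
    · subst hri
      rw [if_pos rfl, if_neg hij, orient_self_left, if_neg (lt_irrefl _), mul_zero, zero_add,
        add_zero]
      refine card_filter_le_sideRank _ _ _ fun s hs => ?_
      have hsk : s ≠ k := by
        rintro rfl
        rw [orient_self_left] at hs
        exact lt_irrefl _ hs
      rw [orient_rotate (q (r, s))] at hs
      exact ⟨hsk, (hq.pair r j s k l hij hsk).1.1 hs⟩
    by_cases hrj : r = j
    · subst hrj
      rw [if_neg hri, if_pos rfl, orient_self_right, if_neg (lt_irrefl _), mul_zero, zero_add,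
        zero_add]
      refine card_filter_le_sideRank _ _ _ fun s hs => ?_
      have hsl : s ≠ l := by
        rintro rfl
        rw [orient_self_right] at hs
        exact lt_irrefl _ hs
      rw [← orient_rotate] at hs
      refine ⟨hsl, ?_⟩
      rw [← (hq.pair r i l s k hij.symm hsl.symm).1.1 hs, not_lt]
      exact ⟨le_of_lt, fun h => lt_of_le_of_ne h hsl⟩
    · rw [if_neg hri, if_neg hrj, add_zero, add_zero]
      by_cases h : 0 < orient (C.pt i) (C.pt j) (C.pt r)
      · rw [if_pos h, mul_one]
        exact (Finset.card_le_univ _).trans (Fintype.card_fin m).le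
      · rw [if_neg h, mul_zero, Nat.le_zero, Finset.card_eq_zero]
        exact Finset.filter_false_of_mem fun s _ hs =>
          h ((hq.distinct i j r k l s hij (Ne.symm hri) (Ne.symm hrj)).1.1 hs)
  rw [leftDegree_prod]
  refine (Finset.sum_le_sum fun r _ => key r).trans ?_
  simp only [Finset.sum_add_distrib, ← Finset.mul_sum, Finset.sum_ite_eq', Finset.mem_univ,
    if_true, leftDegree, Finset.card_filter]
  exact le_rfl

lemma IsBlowup.leftDegree_add_le (hq : IsBlowup C m q) (i : ι) (k l : Fin m) :
    leftDegree q (i, k) (i, l) + l ≤ m * C.half + k := by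
  classical
  have hm : 0 < m := k.pos
  have hhalf : 1 ≤ C.half := le_trans (Nat.le_add_left 1 _) (C.card_left i)
  have hsplit : leftDegree q (i, k) (i, l) =
      ∑ r ∈ Finset.univ.erase i, (Finset.univ.filter fun s =>
        0 < orient (q (i, k)) (q (i, l)) (q (r, s))).card +
      (Finset.univ.filter fun s => 0 < orient (q (i, k)) (q (i, l)) (q (i, s))).card := by
    rw [leftDegree_prod, Finset.sum_erase_add _ _ (Finset.mem_univ i)]
  have hcl : ∀ s, 0 < orient (q (i, k)) (q (i, l)) (q (i, s)) → k ≠ l → (k ≠ s ∧ l ≠ s) ∧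
      0 < ((l : ℕ) - (k : ℕ) : ℝ) * ((s : ℕ) - (k : ℕ)) * ((s : ℕ) - (l : ℕ)) := by
    intro s hs hkl
    have hks : k ≠ s := by
      rintro rfl
      rw [orient_self_left] at hs
      exact lt_irrefl _ hs
    have hls : l ≠ s := by
      rintro rfl
      rw [orient_self_right] at hs
      exact lt_irrefl _ hs
    exact ⟨⟨hks, hls⟩, (hq.cluster i k l s hkl hks hls).1.1 hs⟩
  rcases lt_trichotomy k l with h | h | h
  · have h₁ : ∑ r ∈ Finset.univ.erase i, (Finset.univ.filter fun s =>
        0 < orient (q (i, k)) (q (i, l)) (q (r, s))).card ≤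
        m * (Finset.univ.filter fun j => 0 < orient (C.pt i) (C.pivot i) (C.pt j)).card := by
      rw [Finset.card_filter, Finset.mul_sum]
      refine (Finset.sum_le_sum fun r hr => ?_).trans
        (Finset.sum_le_sum_of_subset (Finset.erase_subset _ _))
      have hr := Finset.ne_of_mem_erase hr
      split_ifs with hσ
      · exact (Finset.card_le_univ _).trans (by simp)
      · rw [mul_zero, Nat.le_zero, Finset.card_eq_zero]
        exact Finset.filter_false_of_mem fun s _ hs =>
          hσ (((hq.pair i r k l s hr.symm h.ne).1.1 hs).1 h)
    have h₂ : (Finset.univ.filter fun s =>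
        0 < orient (q (i, k)) (q (i, l)) (q (i, s))).card + (l + 1) ≤ m + k := by
      have hsub : (Finset.univ.filter fun s => 0 < orient (q (i, k)) (q (i, l)) (q (i, s))) ⊆
          Finset.Iio k ∪ Finset.Ioi l := by
        intro s hs
        obtain ⟨⟨hks, hls⟩, hs⟩ := hcl s (Finset.mem_filter.1 hs).2 h.ne
        rw [Finset.mem_union, Finset.mem_Iio, Finset.mem_Ioi]
        by_contra! hcon
        have hk : (k : ℕ) ≤ (s : ℕ) := hcon.1
        have hl : (s : ℕ) ≤ (l : ℕ) := hcon.2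
        have hkl : (k : ℕ) < (l : ℕ) := h
        have hk : ((k : ℕ) : ℝ) ≤ (s : ℕ) := by exact_mod_cast hk
        have hl : ((s : ℕ) : ℝ) ≤ (l : ℕ) := by exact_mod_cast hl
        have hkl : ((k : ℕ) : ℝ) < (l : ℕ) := by exact_mod_cast hkl
        exact absurd hs (not_lt.2 (mul_nonpos_of_nonneg_of_nonpos
          (mul_nonneg (sub_nonneg.2 hkl.le) (sub_nonneg.2 hk)) (sub_nonpos.2 hl)))
      have := (Finset.card_le_card hsub).trans (Finset.card_union_le _ _)
      rw [Fin.card_Iio, Fin.card_Ioi] at this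
      omega
    have h₃ := Nat.mul_le_mul_left m (C.card_left i)
    rw [mul_add, mul_one] at h₃
    omega
  · subst h
    rw [leftDegree_self]
    omega
  · have h₁ : ∑ r ∈ Finset.univ.erase i, (Finset.univ.filter fun s =>
        0 < orient (q (i, k)) (q (i, l)) (q (r, s))).card ≤
        m * (Finset.univ.filter fun j => orient (C.pt i) (C.pivot i) (C.pt j) < 0).card := by
      rw [Finset.card_filter, Finset.mul_sum]
      refine (Finset.sum_le_sum fun r hr => ?_).trans
        (Finset.sum_le_sum_of_subset (Finset.erase_subset _ _))
      have hr := Finset.ne_of_mem_erase hr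
      split_ifs with hσ
      · exact (Finset.card_le_univ _).trans (by simp)
      · rw [mul_zero, Nat.le_zero, Finset.card_eq_zero]
        refine Finset.filter_false_of_mem fun s _ hs => ?_
        have := (hq.pair i r k l s hr.symm h.ne').1.1 hs
        exact h.not_gt (this.2 (lt_of_le_of_ne (not_lt.1 hσ) (C.orient_pivot_ne i r hr).symm))
    have h₂ : (Finset.univ.filter fun s =>
        0 < orient (q (i, k)) (q (i, l)) (q (i, s))).card + l ≤ k := by
      have hsub : (Finset.univ.filter fun s => 0 < orient (q (i, k)) (q (i, l)) (q (i, s))) ⊆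
          Finset.Ioo l k := by
        intro s hs
        obtain ⟨⟨hks, hls⟩, hs⟩ := hcl s (Finset.mem_filter.1 hs).2 h.ne'
        have hlk : (l : ℕ) < (k : ℕ) := h
        have hlk : ((l : ℕ) : ℝ) < (k : ℕ) := by exact_mod_cast hlk
        rw [mul_assoc] at hs
        have hs := neg_of_mul_pos_right hs (sub_neg.2 hlk).le
        rcases mul_neg_iff.1 hs with ⟨h₁, h₂⟩ | ⟨h₁, h₂⟩
        · rw [sub_pos] at h₁
          rw [sub_neg] at h₂
          linarith
        · rw [sub_neg, Nat.cast_lt] at h₁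
          rw [sub_pos, Nat.cast_lt] at h₂
          exact Finset.mem_Ioo.2 ⟨h₂, h₁⟩
      have := Finset.card_le_card hsub
      rw [Fin.card_Ioo] at this
      have hlk : (l : ℕ) < (k : ℕ) := h
      omega
    have h₃ := Nat.mul_le_mul_left m (C.card_right i)
    omega

lemma sum_sq_distinct_le (m : ℕ) (R : ℝ) (hR : 0 ≤ R) (σ τ : Prop) [Decidable σ] [Decidable τ] :
    ∑ k : Fin m, ∑ l : Fin m, (m * R + sideRank σ k + sideRank τ l) ^ 2 ≤
      (m : ℝ) ^ 4 * (R * (R + 2) + 7 / 6) := by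
  have e₁ : ∀ k : Fin m, ∑ l : Fin m, (m * R + sideRank σ k + sideRank τ l) ^ 2 =
      m * (m * R + sideRank σ k) ^ 2 + 2 * (m * R + sideRank σ k) * (m * (m - 1) / 2) +
        m * (m - 1) * (2 * m - 1) / 6 := by
    intro k
    rw [sum_sideRank m τ fun x => (m * R + sideRank σ k + x) ^ 2]
    simp only [add_sq, Finset.sum_add_distrib, ← Finset.mul_sum, sum_cast_fin, sum_cast_fin_sq,
      Finset.sum_const, Finset.card_univ, Fintype.card_fin, nsmul_eq_mul]
    ring
  simp only [e₁]
  rw [sum_sideRank m σ fun x => m * (m * R + x) ^ 2 + 2 * (m * R + x) * (m * (m - 1) / 2) +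
        m * (m - 1) * (2 * m - 1) / 6]
  have e₂ : ∀ k : Fin m, m * (m * R + ((k : ℕ) : ℝ)) ^ 2 +
      2 * (m * R + ((k : ℕ) : ℝ)) * (m * (m - 1) / 2) + m * (m - 1) * (2 * m - 1) / 6 =
      m * ((k : ℕ) : ℝ) ^ 2 + (2 * m ^ 2 * R + m * (m - 1)) * ((k : ℕ) : ℝ) +
      (m ^ 3 * R ^ 2 + m ^ 2 * R * (m - 1) + m * (m - 1) * (2 * m - 1) / 6) := fun k => by ring
  simp only [e₂, Finset.sum_add_distrib, ← Finset.mul_sum, sum_cast_fin, sum_cast_fin_sq,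
    Finset.sum_const, Finset.card_univ, Fintype.card_fin, nsmul_eq_mul]
  rcases Nat.eq_zero_or_pos m with rfl | hm
  · simp
  have hm : (1 : ℝ) ≤ m := by exact_mod_cast hm
  have h₁ : 0 ≤ (m : ℝ) ^ 3 * R := by positivity
  have h₂ : 0 ≤ (m : ℝ) ^ 2 * (m - 1) := mul_nonneg (by positivity) (by linarith)
  have h₃ : 0 ≤ (m : ℝ) ^ 2 := by positivity
  nlinarith

lemma sum_sq_same_le (m : ℕ) (h : ℝ) :
    ∑ k : Fin m, ∑ l : Fin m, (m * h + (k : ℕ) - (l : ℕ)) ^ 2 ≤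
      (m : ℝ) ^ 4 * (h ^ 2 + 1 / 6) := by
  simp only [sub_sq, add_sq, mul_add, add_mul, Finset.sum_add_distrib, Finset.sum_sub_distrib,
    ← Finset.mul_sum, ← Finset.sum_mul, sum_cast_fin, sum_cast_fin_sq,
    Finset.sum_const, Finset.card_univ, Fintype.card_fin, nsmul_eq_mul]
  nlinarith [sq_nonneg (m : ℝ)]

lemma IsBlowup.sum_sq_le (hq : IsBlowup C m q) :
    ∑ x, ∑ y, (leftDegree q x y : ℝ) ^ 2 ≤ (m : ℝ) ^ 4 *
      ((∑ i, ∑ j, leftDegree C.pt i j * (leftDegree C.pt i j + 2) : ℕ) +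
        7 / 6 * (Fintype.card ι * (Fintype.card ι - 1)) +
        Fintype.card ι * ((C.half : ℝ) ^ 2 + 1 / 6)) := by
  classical
  have key : ∀ i j, ∑ k, ∑ l, (leftDegree q (i, k) (j, l) : ℝ) ^ 2 ≤ (m : ℝ) ^ 4 *
      ((leftDegree C.pt i j : ℝ) * (leftDegree C.pt i j + 2) + 7 / 6 +
        if i = j then (C.half : ℝ) ^ 2 - 1 else 0) := by
    intro i j
    by_cases hij : i = j
    · subst hij
      rw [leftDegree_self, if_pos rfl]
      refine (Finset.sum_le_sum fun k _ => Finset.sum_le_sum fun l _ => ?_).trans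
        ((sum_sq_same_le m C.half).trans_eq ?_)
      · have h : (leftDegree q (i, k) (i, l) : ℝ) + (l : ℕ) ≤ m * C.half + (k : ℕ) := by
          exact_mod_cast hq.leftDegree_add_le i k l
        exact pow_le_pow_left₀ (Nat.cast_nonneg _) (by linarith) 2
      · push_cast
        ring
    · rw [if_neg hij, add_zero]
      refine (Finset.sum_le_sum fun k _ => Finset.sum_le_sum fun l _ => ?_).trans
        (sum_sq_distinct_le m _ (Nat.cast_nonneg _)
          (0 < orient (C.pt i) (C.pivot i) (C.pt j))
          (¬ 0 < orient (C.pt j) (C.pivot j) (C.pt i)))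
      exact pow_le_pow_left₀ (Nat.cast_nonneg _) (by exact_mod_cast hq.leftDegree_le hij k l) 2
  calc ∑ x, ∑ y, (leftDegree q x y : ℝ) ^ 2
      = ∑ i, ∑ j, ∑ k, ∑ l, (leftDegree q (i, k) (j, l) : ℝ) ^ 2 := by
        simp only [Fintype.sum_prod_type]
        exact Finset.sum_congr rfl fun i _ => Finset.sum_comm
    _ ≤ _ := Finset.sum_le_sum fun i _ => Finset.sum_le_sum fun j _ => key i j
    _ = _ := by
        simp only [← Finset.mul_sum, Finset.sum_add_distrib, Finset.sum_ite_eq, Finset.mem_univ,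
          if_true, Finset.sum_const, Finset.card_univ, nsmul_eq_mul]
        push_cast
        ring

end

lemma orient_eq_zero_of_collinear {a b c : ℝ × ℝ}
    (h : Collinear ℝ ({a, b, c} : Set (ℝ × ℝ))) : orient a b c = 0 := by
  obtain ⟨v, hv⟩ := (collinear_iff_of_mem (p₀ := a) (by simp)).1 h
  obtain ⟨s, rfl⟩ := hv b (by simp)
  obtain ⟨t, rfl⟩ := hv c (by simp)
  simp only [orient, vadd_eq_add, Prod.fst_add, Prod.snd_add, Prod.smul_fst, Prod.smul_snd,
    smul_eq_mul]
  ring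

lemma GenPos.mono {P Q : Finset (ℝ × ℝ)} (hP : GenPos P) (h : Q ⊆ P) : GenPos Q :=
  fun p hp q hq r hr => hP p (h hp) q (h hq) r (h hr)

section

variable {ι : Type*} [Fintype ι] {C : HalvedConfig ι} {m : ℕ} {q : ι × Fin m → ℝ × ℝ}

lemma IsBlowup.orient_ne_zero (hq : IsBlowup C m q) {x y z : ι × Fin m} (hxy : x ≠ y)
    (hxz : x ≠ z) (hyz : y ≠ z) : orient (q x) (q y) (q z) ≠ 0 := by
  obtain ⟨i, k⟩ := x
  obtain ⟨j, l⟩ := y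
  obtain ⟨r, s⟩ := z
  by_cases hij : i = j
  · subst hij
    have hkl : k ≠ l := fun h => hxy (by rw [h])
    by_cases hir : i = r
    · subst hir
      exact (hq.cluster i k l s hkl (fun h => hxz (by rw [h])) fun h => hyz (by rw [h])).2
    · exact (hq.pair i r k l s hir hkl).2
  by_cases hir : i = r
  · subst hir
    rw [orient_rotate (q (i, s))]
    exact (hq.pair i j s k l hij fun h => hxz (by rw [h])).2
  by_cases hjr : j = r
  · subst hjr
    rw [← orient_rotate]
    exact (hq.pair j i l s k (Ne.symm hij) fun h => hyz (by rw [h])).2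
  · exact (hq.distinct i j r k l s hij hir hjr).2

lemma IsBlowup.injective (hq : IsBlowup C m q) (hι : 2 < Fintype.card ι) :
    Function.Injective q := by
  classical
  intro x y hxy
  by_contra hne
  obtain ⟨r, -, hr⟩ := Finset.exists_mem_notMem_of_card_lt_card
    (s := {x.1, y.1}) (t := (Finset.univ : Finset ι)) (Finset.card_le_two.trans_lt hι)
  simp only [Finset.mem_insert, Finset.mem_singleton, not_or] at hr
  refine hq.orient_ne_zero (z := (r, x.2)) hne (fun h => hr.1 (by rw [h]))
    (fun h => hr.2 (by rw [h])) ?_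
  rw [hxy, orient_self]

end

/-- Every configuration yields large point sets in general position with few convex
quadrilaterals. -/
lemma HalvedConfig.exists_finset {ι : Type*} [Fintype ι] (C : HalvedConfig ι)
    (hι : 2 < Fintype.card ι) (m : ℕ) :
    ∃ P : Finset (ℝ × ℝ), P.card = Fintype.card ι * m ∧ GenPos P ∧
      (crNum P : ℝ) + 3 * ((Fintype.card ι * m).choose 4 : ℕ) ≤ (m : ℝ) ^ 4 *
      ((∑ i, ∑ j, leftDegree C.pt i j * (leftDegree C.pt i j + 2) : ℕ) +
        7 / 6 * (Fintype.card ι * (Fintype.card ι - 1)) +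
        Fintype.card ι * ((C.half : ℝ) ^ 2 + 1 / 6)) / 2 := by
  classical
  have : Nontrivial ι := Fintype.one_lt_card_iff_nontrivial.1 (by omega)
  obtain ⟨q, hq⟩ := exists_isBlowup C m
  set P : Finset (ℝ × ℝ) := Finset.univ.map ⟨q, hq.injective hι⟩ with hP
  have hcard : P.card = Fintype.card ι * m := by
    rw [hP, Finset.card_map, Finset.card_univ, Fintype.card_prod, Fintype.card_fin]
  have hne : ∀ a ∈ P, ∀ b ∈ P, ∀ c ∈ P, a ≠ b → a ≠ c → b ≠ c → orient a b c ≠ 0 := by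
    simp only [hP, Finset.mem_map, Finset.mem_univ, true_and, Function.Embedding.coeFn_mk,
      forall_exists_index, forall_apply_eq_imp_iff]
    exact fun x y z hxy hxz hyz => hq.orient_ne_zero (ne_of_apply_ne q hxy)
      (ne_of_apply_ne q hxz) (ne_of_apply_ne q hyz)
  refine ⟨P, hcard, fun a ha b hb c hc hab hac hbc h =>
    hne a ha b hb c hc hab hac hbc (orient_eq_zero_of_collinear h), ?_⟩
  have hleft : ∀ x y, numLeft P (q x) (q y) = leftDegree q x y := by
    intro x y
    rw [numLeft, hP, Finset.filter_map, Finset.card_map, leftDegree]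
    congr!
  have hcr := crNum_add_le P hne
  rw [hcard] at hcr
  have hsum : ∑ a ∈ P, ∑ b ∈ P, (numLeft P a b).choose 2 =
      ∑ x, ∑ y, (leftDegree q x y).choose 2 := by
    simp only [← hleft]
    rw [hP]
    simp only [Finset.sum_map, Function.Embedding.coeFn_mk]
  rw [hsum] at hcr
  have hcr : (crNum P : ℝ) + 3 * ((Fintype.card ι * m).choose 4 : ℕ) ≤
      ∑ x, ∑ y, ((leftDegree q x y).choose 2 : ℝ) := by exact_mod_cast hcr
  refine hcr.trans ?_
  rw [le_div_iff₀ two_pos]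
  refine le_trans ?_ hq.sum_sq_le
  simp only [Finset.sum_mul]
  refine Finset.sum_le_sum fun x _ => Finset.sum_le_sum fun y _ => ?_
  rw [Nat.cast_choose_two]
  nlinarith [Nat.cast_nonneg (α := ℝ) (leftDegree q x y)]

lemma exists_baseConfig_finset (m : ℕ) :
    ∃ P : Finset (ℝ × ℝ), P.card = 108 * m ∧ GenPos P ∧
      (crNum P : ℝ) + 3 * ((108 * m).choose 4 : ℕ) ≤ (m : ℝ) ^ 4 * 38325918 / 2 := by
  have hcard : Fintype.card (Fin basePoints.length) = 108 := by
    rw [Fintype.card_fin, length_basePoints]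
  obtain ⟨P, h₁, h₂, h₃⟩ := baseConfig.exists_finset (by rw [hcard]; norm_num) m
  rw [hcard] at h₁ h₃
  refine ⟨P, h₁, h₂, h₃.trans_eq ?_⟩
  rw [sum_leftDegree_baseConfig, show baseConfig.half = 54 from rfl]
  norm_num

lemma exists_genPos (n : ℕ) : ∃ P : Finset (ℝ × ℝ), P.card = n ∧ GenPos P := by
  obtain ⟨P, hcard, hP, -⟩ := exists_baseConfig_finset n
  obtain ⟨Q, hQ, hQn⟩ := Finset.exists_subset_card_eq (show n ≤ P.card by omega)
  exact ⟨Q, hQn, hP.mono hQ⟩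

lemma exists_crNum_eq_rcn (n : ℕ) :
    ∃ P : Finset (ℝ × ℝ), P.card = n ∧ GenPos P ∧ crNum P = rcn n := by
  obtain ⟨P, hcard, hP⟩ := exists_genPos n
  exact Nat.sInf_mem (s := {c | ∃ P : Finset (ℝ × ℝ), P.card = n ∧ GenPos P ∧ crNum P = c})
    ⟨_, P, hcard, hP, rfl⟩

lemma rcn_le_crNum {n : ℕ} {P : Finset (ℝ × ℝ)} (hcard : P.card = n) (hP : GenPos P) :
    rcn n ≤ crNum P :=
  Nat.sInf_le ⟨P, hcard, hP, rfl⟩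

lemma crNum_le_choose (P : Finset (ℝ × ℝ)) : crNum P ≤ P.card.choose 4 := by
  classical
  rw [crNum_eq_card, ← Finset.card_powersetCard]
  exact Finset.card_filter_le _ _

lemma sum_crNum_erase (P : Finset (ℝ × ℝ)) :
    ∑ p ∈ P, crNum (P.erase p) = crNum P * (P.card - 4) := by
  classical
  have h : ∀ p ∈ P, crNum (P.erase p) = ∑ Q ∈ (P.powersetCard 4).filter fun Q : Finset (ℝ × ℝ) =>
      ConvexPos (Q : Set (ℝ × ℝ)), if p ∈ P \ Q then 1 else 0 := by
    intro p hp
    rw [crNum_eq_card, ← Finset.card_filter, Finset.filter_filter]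
    congr 1
    ext Q
    simp only [Finset.mem_filter, Finset.mem_powersetCard, Finset.subset_erase, Finset.mem_sdiff]
    tauto
  rw [Finset.sum_congr rfl h, Finset.sum_comm, crNum_eq_card, ← smul_eq_mul,
    ← Finset.sum_const]
  refine Finset.sum_congr rfl fun Q hQ => ?_
  obtain ⟨hQP, hQ⟩ := Finset.mem_powersetCard.1 (Finset.mem_filter.1 hQ).1
  rw [← Finset.card_filter, ← hQ, ← Finset.card_sdiff_of_subset hQP]
  congr 1
  ext p
  simp only [Finset.mem_filter, Finset.mem_sdiff]
  tauto

lemma succ_mul_rcn_le (n : ℕ) : (n + 1) * rcn n ≤ rcn (n + 1) * (n + 1 - 4) := by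
  classical
  obtain ⟨P, hcard, hP, hcr⟩ := exists_crNum_eq_rcn (n + 1)
  rw [← hcr, ← hcard, ← sum_crNum_erase, ← smul_eq_mul, ← Finset.sum_const]
  refine Finset.sum_le_sum fun p hp => rcn_le_crNum ?_ (hP.mono (Finset.erase_subset _ _))
  rw [Finset.card_erase_of_mem hp, hcard, Nat.add_sub_cancel]

lemma monotone_rcn_div_choose : Monotone fun n : ℕ => (rcn n : ℝ) / (n.choose 4 : ℝ) := by
  refine monotone_nat_of_le_succ fun n => ?_
  rcases lt_or_ge n 4 with hn | hn
  · rw [Nat.choose_eq_zero_of_lt hn, Nat.cast_zero, div_zero]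
    positivity
  have h₁ : 0 < n.choose 4 := Nat.choose_pos hn
  have h₂ : 0 < (n + 1).choose 4 := Nat.choose_pos (by omega)
  rw [div_le_div_iff₀ (by exact_mod_cast h₁) (by exact_mod_cast h₂)]
  have h₃ := succ_mul_rcn_le n
  have h₄ := Nat.choose_mul_succ_eq n 4
  have h₅ : 0 < n + 1 - 4 := by omega
  have : rcn n * (n + 1).choose 4 ≤ rcn (n + 1) * n.choose 4 := by
    refine Nat.le_of_mul_le_mul_right ?_ h₅
    calc rcn n * (n + 1).choose 4 * (n + 1 - 4) = (n + 1) * rcn n * n.choose 4 := by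
          rw [mul_assoc, ← h₄]
          ring
      _ ≤ rcn (n + 1) * (n + 1 - 4) * n.choose 4 := Nat.mul_le_mul_right _ h₃
      _ = rcn (n + 1) * n.choose 4 * (n + 1 - 4) := by ring
  exact_mod_cast this

lemma rcn_div_choose_le_one (n : ℕ) : (rcn n : ℝ) / (n.choose 4 : ℝ) ≤ 1 := by
  obtain ⟨P, hcard, -, hcr⟩ := exists_crNum_eq_rcn n
  refine div_le_one_of_le₀ ?_ (Nat.cast_nonneg _)
  rw [← hcr, ← hcard]
  exact_mod_cast crNum_le_choose P

lemma rcn_div_choose_le (k : ℕ) (hk : 0 < k) :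
    (rcn (108 * (k + 1)) : ℝ) / ((108 * (k + 1)).choose 4 : ℝ) ≤
      12 * 38325918 / 108 ^ 4 * (1 + 1 / (k : ℝ)) ^ 4 - 3 := by
  obtain ⟨P, hcard, hP, hcr⟩ := exists_baseConfig_finset (k + 1)
  have hrcn : (rcn (108 * (k + 1)) : ℝ) ≤ crNum P := by exact_mod_cast rcn_le_crNum hcard hP
  have hk : (0 : ℝ) < k := by exact_mod_cast hk
  have hchoose : (108 * (k : ℝ)) ^ 4 ≤ 24 * ((108 * (k + 1)).choose 4 : ℕ) := by
    have h : (108 * k) ^ 4 ≤ (108 * (k + 1) + 1 - 4) ^ 4 := Nat.pow_le_pow_left (by omega) 4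
    have := Nat.pow_sub_le_descFactorial (108 * (k + 1)) 4
    rw [Nat.descFactorial_eq_factorial_mul_choose] at this
    exact_mod_cast h.trans this
  have hpos : (0 : ℝ) < ((108 * (k + 1)).choose 4 : ℕ) := by
    have : 0 < (108 * (k : ℝ)) ^ 4 := by positivity
    linarith
  rw [div_le_iff₀ hpos, sub_mul, le_sub_iff_add_le]
  refine (add_le_add_left hrcn _).trans (hcr.trans ?_)
  calc ((k + 1 : ℕ) : ℝ) ^ 4 * 38325918 / 2
      = 12 * 38325918 / 108 ^ 4 * (1 + 1 / (k : ℝ)) ^ 4 * ((108 * (k : ℝ)) ^ 4 / 24) := by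
        push_cast
        field_simp
        ring
    _ ≤ _ := by
        gcongr
        linarith

/-- The rectilinear crossing number constant: `cr(K_n)/C(n,4)` converges to a limit
`q* ≤ 83247328/218791125 < 0.380488`; in particular
`limsup_n cr(K_n)/C(n,4) ≤ 83247328/218791125`. -/
theorem rectilinear_crossing_constant_upper_bound :
    (∃ q : ℝ, Filter.Tendsto (fun n : ℕ => (rcn n : ℝ) / (n.choose 4 : ℝ))
        Filter.atTop (nhds q) ∧ q ≤ 83247328 / 218791125) ∧
    Filter.limsup (fun n : ℕ => (rcn n : ℝ) / (n.choose 4 : ℝ)) Filter.atTop ≤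
      83247328 / 218791125 ∧
    (83247328 / 218791125 : ℝ) < 0.380488 := by
  obtain ⟨q, hq⟩ : ∃ q : ℝ, Filter.Tendsto (fun n : ℕ => (rcn n : ℝ) / (n.choose 4 : ℝ))
      Filter.atTop (nhds q) :=
    ⟨_, tendsto_atTop_ciSup monotone_rcn_div_choose
      ⟨1, Set.forall_mem_range.2 rcn_div_choose_le_one⟩⟩
  have hsub : Filter.Tendsto (fun k : ℕ => 108 * (k + 1)) Filter.atTop Filter.atTop :=
    Filter.tendsto_atTop_mono (fun k => show k ≤ 108 * (k + 1) by omega) Filter.tendsto_id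
  have hlim : Filter.Tendsto
      (fun k : ℕ => 12 * 38325918 / 108 ^ 4 * (1 + 1 / (k : ℝ)) ^ 4 - 3) Filter.atTop
      (nhds (12 * 38325918 / 108 ^ 4 * (1 + 0) ^ 4 - 3)) :=
    (((tendsto_one_div_atTop_nhds_zero_nat (𝕜 := ℝ)).const_add 1).pow 4).const_mul _ |>.sub_const 3
  have hle : q ≤ 83247328 / 218791125 := by
    refine (le_of_tendsto_of_tendsto (hq.comp hsub) hlim ?_).trans (by norm_num)
    filter_upwards [Filter.eventually_gt_atTop 0] with k hk using rcn_div_choose_le k hk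
  exact ⟨⟨q, hq, hle⟩, hq.limsup_eq.trans_le hle, by norm_num⟩
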